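/- The function r ↦ (E(r) − r'² K(r))/(r² K(r)) is strictly decreasing on (0,1), with limit 1/2 as r → 0⁺ and limit 0 as r → 1⁻ (so it maps (0,1) onto (0, 1/2)). -/

import Mathlib

open Real Set Filter Topology

/-- The complete elliptic integral of the second kind. -/
noncomputable def ellipticE (r : ℝ) : ℝ :=
  ∫ θ in (0:ℝ)..(π/2), Real.sqrt (1 - r^2 * Real.sin θ ^ 2)

/-- The complete elliptic integral of the first kind. -/
noncomputable def ellipticK (r : ℝ) : ℝ :=
  ∫ θ in (0:ℝ)..(π/2), (1 - r^2 * Real.sin θ ^ 2) ^ (-(1:ℝ)/2)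

noncomputable def auxW (r c : ℝ) : ℝ := (Real.sqrt (1 - r^2 * (1 - c)))⁻¹

noncomputable def auxC (r : ℝ) : ℝ := ∫ θ in (0:ℝ)..(π/2), Real.cos θ ^ 2 * auxW r (Real.cos θ ^ 2)

noncomputable def auxK (r : ℝ) : ℝ := ∫ θ in (0:ℝ)..(π/2), auxW r (Real.cos θ ^ 2)

lemma aux_pos {r c : ℝ} (hr : r ∈ Ioo (0:ℝ) 1) (hc : 0 ≤ c) : 0 < 1 - r^2 * (1 - c) := by
  obtain ⟨h0, h1⟩ := hr
  have : 0 < 1 - r^2 := by nlinarith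
  have : 0 ≤ r^2 * c := by positivity
  nlinarith

lemma auxW_pos {r c : ℝ} (hr : r ∈ Ioo (0:ℝ) 1) (hc : 0 ≤ c) : 0 < auxW r c :=
  inv_pos.2 (Real.sqrt_pos.2 (aux_pos hr hc))

lemma auxW_cont {r : ℝ} (hr : r ∈ Ioo (0:ℝ) 1) : Continuous fun θ : ℝ => auxW r (Real.cos θ ^ 2) := by
  unfold auxW
  refine Continuous.inv₀ (by fun_prop) fun θ => ?_
  exact (Real.sqrt_pos.2 (aux_pos hr (sq_nonneg _))).ne'

lemma auxK_eq {r : ℝ} (hr : r ∈ Ioo (0:ℝ) 1) : ellipticK r = auxK r := by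
  unfold ellipticK auxK
  refine intervalIntegral.integral_congr fun θ _ => ?_
  have h := aux_pos hr (sq_nonneg (Real.cos θ))
  simp only [auxW, Real.sin_sq]
  rw [neg_div, Real.rpow_neg h.le, Real.sqrt_eq_rpow]

lemma auxE_eq {r : ℝ} (hr : r ∈ Ioo (0:ℝ) 1) :
    ellipticE r - (1 - r^2) * ellipticK r = r^2 * auxC r := by
  have hc := auxW_cont hr
  rw [auxK_eq hr]
  unfold ellipticE auxK auxC
  rw [← intervalIntegral.integral_const_mul, ← intervalIntegral.integral_const_mul,
    ← intervalIntegral.integral_sub]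
  · refine intervalIntegral.integral_congr fun θ _ => ?_
    have h := aux_pos hr (sq_nonneg (Real.cos θ))
    have h2 := Real.sqrt_pos.2 h
    simp only [auxW, Real.sin_sq]
    have h3 := Real.sq_sqrt h.le
    field_simp
    rw [h3]; ring
  · exact Continuous.intervalIntegrable (by fun_prop) _ _
  · exact Continuous.intervalIntegrable (by fun_prop) _ _

lemma aux_pi : (0:ℝ) ≤ π/2 := by positivity

lemma auxW_ge {r c : ℝ} (hr : r ∈ Ioo (0:ℝ) 1) (hc : 0 ≤ c) (hc1 : c ≤ 1) : 1 ≤ auxW r c := by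
  refine (one_le_inv₀ (Real.sqrt_pos.2 (aux_pos hr hc))).2 ?_
  refine Real.sqrt_le_one.2 ?_
  have : 0 ≤ r^2 * (1 - c) := mul_nonneg (sq_nonneg _) (by linarith)
  linarith

lemma auxW_le {r c : ℝ} (hr : r ∈ Ioo (0:ℝ) 1) (hc : 0 ≤ c) : auxW r c ≤ auxW r 0 := by
  refine inv_anti₀ (Real.sqrt_pos.2 (aux_pos hr le_rfl)) (Real.sqrt_le_sqrt ?_)
  have : 0 ≤ r^2 * c := by positivity
  nlinarith

lemma auxK_ge {r : ℝ} (hr : r ∈ Ioo (0:ℝ) 1) : π/2 ≤ auxK r := by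
  have : ∫ θ in (0:ℝ)..(π/2), (1:ℝ) = π/2 := by simp
  rw [← this]
  exact intervalIntegral.integral_mono_on aux_pi (by simp)
    ((auxW_cont hr).intervalIntegrable _ _)
    fun θ _ => auxW_ge hr (sq_nonneg _) (Real.cos_sq_le_one θ)

lemma auxK_le {r : ℝ} (hr : r ∈ Ioo (0:ℝ) 1) : auxK r ≤ π/2 * auxW r 0 := by
  have : ∫ θ in (0:ℝ)..(π/2), auxW r 0 = π/2 * auxW r 0 := by simp
  rw [← this]
  exact intervalIntegral.integral_mono_on aux_pi ((auxW_cont hr).intervalIntegrable _ _) (by simp)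
    fun θ _ => auxW_le hr (sq_nonneg _)

lemma aux_cos : ∫ θ in (0:ℝ)..(π/2), Real.cos θ ^ 2 = π/4 := by
  rw [integral_cos_sq]; simp; ring

lemma auxC_int {r : ℝ} (hr : r ∈ Ioo (0:ℝ) 1) :
    Continuous (fun θ : ℝ => Real.cos θ ^ 2 * auxW r (Real.cos θ ^ 2)) := by
  have := auxW_cont hr
  fun_prop

lemma auxC_ge {r : ℝ} (hr : r ∈ Ioo (0:ℝ) 1) : π/4 ≤ auxC r := by
  rw [← aux_cos]
  refine intervalIntegral.integral_mono_on aux_pi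
    (Continuous.intervalIntegrable (by fun_prop) _ _)
    ((auxC_int hr).intervalIntegrable _ _) fun θ _ => ?_
  exact le_mul_of_one_le_right (sq_nonneg _) (auxW_ge hr (sq_nonneg _) (Real.cos_sq_le_one θ))

lemma auxC_le {r : ℝ} (hr : r ∈ Ioo (0:ℝ) 1) : auxC r ≤ π/4 * auxW r 0 := by
  rw [← aux_cos, ← intervalIntegral.integral_mul_const]
  refine intervalIntegral.integral_mono_on aux_pi ((auxC_int hr).intervalIntegrable _ _)
    (Continuous.intervalIntegrable (by fun_prop) _ _) fun θ _ => ?_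
  exact mul_le_mul_of_nonneg_left (auxW_le hr (sq_nonneg _)) (sq_nonneg _)

lemma auxC_le' {r : ℝ} (hr : r ∈ Ioo (0:ℝ) 1) : auxC r ≤ π/2 := by
  have : ∫ θ in (0:ℝ)..(π/2), (1:ℝ) = π/2 := by simp
  rw [← this]
  refine intervalIntegral.integral_mono_on aux_pi ((auxC_int hr).intervalIntegrable _ _)
    (by simp) fun θ _ => ?_
  have hp := aux_pos hr (sq_nonneg (Real.cos θ))
  have h := Real.sqrt_pos.2 hp
  have hc1 := Real.cos_sq_le_one θ
  unfold auxW
  rw [← div_eq_mul_inv, div_le_one h]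
  apply Real.le_sqrt_of_sq_le
  have h0 := sq_nonneg (Real.cos θ)
  have hr1 : r^2 ≤ 1 := by have := hr.1; have := hr.2; nlinarith
  have : Real.cos θ ^ 2 ≤ 1 - r^2 * (1 - Real.cos θ ^ 2) := by nlinarith
  nlinarith

lemma auxK_log {r : ℝ} (hr : r ∈ Ioo (0:ℝ) 1) :
    Real.log (π/2 * (Real.sqrt (1 - r^2))⁻¹) ≤ auxK r := by
  have h1 : 0 < 1 - r^2 := by have := aux_pos hr le_rfl; simpa using this
  set a := Real.sqrt (1 - r^2) with ha
  have ha0 : 0 < a := Real.sqrt_pos.2 h1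
  have hI : ∫ θ in (0:ℝ)..(π/2), (1 / ((a + π/2) - θ)) = Real.log ((a + π/2) / a) := by
    rw [intervalIntegral.integral_comp_sub_left (fun x => 1 / x)]
    rw [integral_one_div_of_pos (by linarith) (by linarith [aux_pi])]
    simp
  have h2 : Real.log (π/2 * a⁻¹) ≤ Real.log ((a + π/2) / a) := by
    apply Real.log_le_log (by positivity)
    rw [div_eq_mul_inv]
    refine mul_le_mul_of_nonneg_right ?_ (inv_nonneg.2 ha0.le)
    linarith
  refine h2.trans ?_
  rw [← hI]
  refine intervalIntegral.integral_mono_on aux_pi ?_ ((auxW_cont hr).intervalIntegrable _ _)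
    fun θ hθ => ?_
  · apply ContinuousOn.intervalIntegrable
    refine ContinuousOn.div (by fun_prop) (by fun_prop) fun θ hθ => ?_
    rw [uIcc_of_le aux_pi] at hθ
    have := hθ.2
    intro h
    linarith
  · have hp := aux_pos hr (sq_nonneg (Real.cos θ))
    have hcos : Real.cos θ ≤ π/2 - θ := by
      rw [← Real.sin_pi_div_two_sub]
      exact Real.sin_le (by linarith [hθ.2])
    have hc0 : 0 ≤ Real.cos θ := Real.cos_nonneg_of_mem_Icc ⟨by linarith [hθ.1, aux_pi], hθ.2⟩
    unfold auxW
    rw [one_div]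
    refine inv_anti₀ (Real.sqrt_pos.2 hp) ?_
    apply Real.sqrt_le_iff.2
    refine ⟨by linarith, ?_⟩
    have hs := Real.sq_sqrt h1.le
    rw [← ha] at hs
    have h5 : (a + Real.cos θ)^2 ≤ (a + π/2 - θ)^2 := by
      apply pow_le_pow_left₀ (by linarith); linarith
    have h6 : r^2 * Real.cos θ ^2 ≤ Real.cos θ ^2 := mul_le_of_le_one_left (sq_nonneg _) (by linarith)
    nlinarith [mul_nonneg ha0.le hc0]

lemma aux_key {r t c m : ℝ} (hr : r ∈ Ioo (0:ℝ) 1) (ht : t ∈ Ioo (0:ℝ) 1) (hrt : r < t)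
    (hc : 0 ≤ c) (hm : 0 ≤ m) (hcm : m < c) :
    auxW t c * auxW r m < auxW t m * auxW r c := by
  have a1 := aux_pos hr hc
  have a2 := aux_pos hr hm
  have a3 := aux_pos ht hc
  have a4 := aux_pos ht hm
  unfold auxW
  rw [← mul_inv, ← mul_inv, ← Real.sqrt_mul a3.le, ← Real.sqrt_mul a4.le]
  refine inv_strictAnti₀ (Real.sqrt_pos.2 (by positivity)) (Real.sqrt_lt_sqrt (by positivity) ?_)
  have : 0 < (c - m) * (t^2 - r^2) := mul_pos (by linarith) (by have := hr.1; nlinarith)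
  nlinarith

lemma aux_anti : StrictAntiOn (fun r : ℝ => auxC r / auxK r) (Ioo 0 1) := by
  intro r hr t ht hrt
  have hKr : 0 < auxK r := lt_of_lt_of_le (by positivity) (auxK_ge hr)
  have hKt : 0 < auxK t := lt_of_lt_of_le (by positivity) (auxK_ge ht)
  have hCr : 0 < auxC r := lt_of_lt_of_le (by positivity) (auxC_ge hr)
  show auxC t / auxK t < auxC r / auxK r
  set m := auxC r / auxK r with hm
  have hm0 : 0 < m := div_pos hCr hKr
  have hmK : auxC r = m * auxK r := by rw [hm]; field_simp
  rw [div_lt_iff₀ hKt]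
  have cr := auxW_cont hr
  have ct := auxW_cont ht
  have key : ∀ c : ℝ, 0 ≤ c → c ≠ m →
      (c - m) * auxW t c * auxW r m < (c - m) * auxW r c * auxW t m := by
    intro c hc hne
    rcases lt_or_gt_of_ne hne with h | h
    · have := aux_key hr ht hrt hm0.le hc h
      nlinarith
    · have := aux_key hr ht hrt hc hm0.le h
      nlinarith
  have hint : ∀ s ∈ Ioo (0:ℝ) 1, ∀ k : ℝ,
      ∫ θ in (0:ℝ)..(π/2), (Real.cos θ ^ 2 - m) * auxW s (Real.cos θ ^ 2) * k
        = (auxC s - m * auxK s) * k := by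
    intro s hs k
    have cs := auxW_cont hs
    rw [intervalIntegral.integral_mul_const]
    unfold auxC auxK
    rw [← intervalIntegral.integral_const_mul, ← intervalIntegral.integral_sub
      (Continuous.intervalIntegrable (by fun_prop) _ _)
      (Continuous.intervalIntegrable (by fun_prop) _ _)]
    congr 1
    refine intervalIntegral.integral_congr fun θ _ => ?_
    ring
  have hlt : ∫ θ in (0:ℝ)..(π/2), (Real.cos θ ^ 2 - m) * auxW t (Real.cos θ ^ 2) * auxW r m
      < ∫ θ in (0:ℝ)..(π/2), (Real.cos θ ^ 2 - m) * auxW r (Real.cos θ ^ 2) * auxW t m := by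
    refine intervalIntegral.integral_lt_integral_of_continuousOn_of_le_of_exists_lt
      (by positivity) (by fun_prop) (by fun_prop) (fun θ _ => ?_) ?_
    · by_cases h : Real.cos θ ^ 2 = m
      · simp [h]
      · exact (key _ (sq_nonneg _) h).le
    · refine ⟨π/2, ⟨aux_pi, le_rfl⟩, key _ (sq_nonneg _) ?_⟩
      simp [hm0.ne]
  rw [hint t ht, hint r hr, hmK, sub_self, zero_mul] at hlt
  have := auxW_pos hr hm0.le
  by_contra hcon
  have : 0 ≤ (auxC t - m * auxK t) * auxW r m := mul_nonneg (by linarith) this.le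
  linarith

lemma aux_eq {r : ℝ} (hr : r ∈ Ioo (0:ℝ) 1) :
    (ellipticE r - (1 - r^2) * ellipticK r) / (r^2 * ellipticK r) = auxC r / auxK r := by
  rw [auxE_eq hr, auxK_eq hr, mul_div_mul_left]
  exact pow_ne_zero 2 hr.1.ne'

/-- Lemma 2.2(4): r ↦ (E(r) − r'²K(r))/(r²K(r)) is strictly decreasing from (0,1) onto (0, 1/2). -/
theorem stmt_5 :
    StrictAntiOn (fun r : ℝ => (ellipticE r - (1 - r^2) * ellipticK r) / (r^2 * ellipticK r))
      (Ioo 0 1) ∧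
    Tendsto (fun r : ℝ => (ellipticE r - (1 - r^2) * ellipticK r) / (r^2 * ellipticK r))
      (𝓝[>] 0) (𝓝 (1/2)) ∧
    Tendsto (fun r : ℝ => (ellipticE r - (1 - r^2) * ellipticK r) / (r^2 * ellipticK r))
      (𝓝[<] 1) (𝓝 0) := by
  refine ⟨aux_anti.congr fun r hr => (aux_eq hr).symm, ?_, ?_⟩
  · have hev : ∀ᶠ r : ℝ in 𝓝[>] 0, r ∈ Ioo (0:ℝ) 1 := Ioo_mem_nhdsGT one_pos
    have hW : Tendsto (fun r : ℝ => auxW r 0) (𝓝[>] 0) (𝓝 1) := by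
      have : ContinuousAt (fun r : ℝ => auxW r 0) 0 := by
        unfold auxW
        exact ContinuousAt.inv₀ (by fun_prop) (by simp)
      have h2 := this.tendsto.mono_left (nhdsWithin_le_nhds (s := Ioi 0))
      simpa [auxW] using h2
    have hpi := Real.pi_pos
    have hC : Tendsto auxC (𝓝[>] 0) (𝓝 (π/4)) := by
      refine tendsto_of_tendsto_of_tendsto_of_le_of_le' tendsto_const_nhds
        (by simpa using hW.const_mul (π/4)) ?_ ?_
      · filter_upwards [hev] with r hr using auxC_ge hr
      · filter_upwards [hev] with r hr using auxC_le hr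
    have hK : Tendsto auxK (𝓝[>] 0) (𝓝 (π/2)) := by
      refine tendsto_of_tendsto_of_tendsto_of_le_of_le' tendsto_const_nhds
        (by simpa using hW.const_mul (π/2)) ?_ ?_
      · filter_upwards [hev] with r hr using auxK_ge hr
      · filter_upwards [hev] with r hr using auxK_le hr
    have := hC.div hK (by positivity)
    have e : π/4 / (π/2) = 1/2 := by field_simp; norm_num
    rw [e] at this
    refine this.congr' ?_
    filter_upwards [hev] with r hr using (aux_eq hr).symm
  · have hev : ∀ᶠ r : ℝ in 𝓝[<] 1, r ∈ Ioo (0:ℝ) 1 := Ioo_mem_nhdsLT one_pos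
    have hs : Tendsto (fun r : ℝ => Real.sqrt (1 - r^2)) (𝓝[<] 1) (𝓝[>] 0) := by
      refine tendsto_nhdsWithin_iff.2 ⟨?_, ?_⟩
      · have : ContinuousAt (fun r : ℝ => Real.sqrt (1 - r^2)) 1 := by fun_prop
        have h2 := this.tendsto.mono_left (nhdsWithin_le_nhds (s := Iio 1))
        simpa using h2
      · filter_upwards [hev] with r hr
        have := aux_pos hr le_rfl
        exact Real.sqrt_pos.2 (by simpa using this)
    have hK : Tendsto auxK (𝓝[<] 1) atTop := by
      refine tendsto_atTop_mono' _ ?_ (Real.tendsto_log_atTop.comp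
        ((tendsto_inv_nhdsGT_zero.comp hs).const_mul_atTop (by positivity : 0 < π/2)))
      filter_upwards [hev] with r hr using auxK_log hr
    have h0 : Tendsto (fun r => π/2 / auxK r) (𝓝[<] 1) (𝓝 0) := hK.const_div_atTop _
    refine tendsto_of_tendsto_of_tendsto_of_le_of_le' tendsto_const_nhds h0 ?_ ?_
    · filter_upwards [hev] with r hr
      rw [aux_eq hr]
      have := auxK_ge hr
      have := auxC_ge hr
      have := Real.pi_pos
      exact div_nonneg (by linarith) (by linarith)
    · filter_upwards [hev] with r hr
      rw [aux_eq hr]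
      have := auxK_ge hr
      have := Real.pi_pos
      exact div_le_div_of_nonneg_right (auxC_le' hr) (by linarith)
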